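/- Let (K, d) be a compact connected metric space with at least two points and p ∈ K a point such that d̃(x, y, K) < ∞ for all x, y ∈ K \ {p} and d̃(x, p, K) = ∞ for all x ∈ K \ {p}. Then K is not the attractor of any iterated function system on K: there is no finite family f₁, …, f_m : K → K of maps, each Lipschitz with some constant λᵢ < 1, such that K = f₁(K) ∪ ⋯ ∪ f_m(K). -/

import Mathlib

open scoped ENNReal NNReal

/-- `chainDistEps A x y ε` is the infimum over all finite chains `x = x₀, x₁, …, x_k = y`
of points of `A` with consecutive distances `< ε` of the sum `∑ dist (xᵢ) (xᵢ₊₁)`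
(`∞` if no such chain exists). -/
noncomputable def chainDistEps {X : Type*} [MetricSpace X] (A : Set X) (x y : X) (ε : ℝ) :
    ℝ≥0∞ :=
  ⨅ (k : ℕ) (c : Fin (k + 1) → X) (_ : c 0 = x) (_ : c (Fin.last k) = y)
    (_ : ∀ i, c i ∈ A) (_ : ∀ i : Fin k, dist (c i.castSucc) (c i.succ) < ε),
    ∑ i : Fin k, ENNReal.ofReal (dist (c i.castSucc) (c i.succ))

/-- `chainDist A x y` is `d̃(x,y,A)`, the limit of `chainDistEps A x y ε` as `ε → 0⁺`;
since `ε ↦ chainDistEps A x y ε` is antitone in `ε`, this limit equals the supremum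
over `ε > 0`. -/
noncomputable def chainDist {X : Type*} [MetricSpace X] (A : Set X) (x y : X) : ℝ≥0∞ :=
  ⨆ (ε : ℝ) (_ : 0 < ε), chainDistEps A x y ε

section ChainDist

variable {X : Type*} [MetricSpace X]

lemma chainDistEps_le_sum (ε : ℝ) {k : ℕ} (c : Fin (k + 1) → X)
    (hc : ∀ i : Fin k, dist (c i.castSucc) (c i.succ) < ε) :
    chainDistEps Set.univ (c 0) (c (Fin.last k)) ε ≤
      ∑ i : Fin k, ENNReal.ofReal (dist (c i.castSucc) (c i.succ)) :=
  iInf_le_of_le k <| iInf_le_of_le c <| iInf_le_of_le rfl <| iInf_le_of_le rfl <|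
    iInf_le_of_le (fun _ => Set.mem_univ _) <| iInf_le_of_le hc le_rfl

lemma chainDistEps_le_add_dist (x : X) {y z : X} {ε : ℝ} (h : dist y z < ε) :
    chainDistEps Set.univ x z ε ≤ chainDistEps Set.univ x y ε + ENNReal.ofReal (dist y z) := by
  conv_rhs => rw [chainDistEps]
  simp only [ENNReal.iInf_add]
  refine le_iInf fun k => le_iInf fun c => le_iInf fun h0 => le_iInf fun hl => le_iInf fun _ =>
    le_iInf fun hc => ?_
  have key := chainDistEps_le_sum ε (Fin.snoc c z : Fin (k + 1 + 1) → X) (fun i => by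
    induction i using Fin.lastCases with
    | last => simpa [hl] using h
    | cast i => simpa only [Fin.succ_castSucc, Fin.snoc_castSucc] using hc i)
  rw [Fin.sum_univ_castSucc] at key
  have hz : (0 : Fin (k + 1 + 1)) = Fin.castSucc 0 := rfl
  rw [hz] at key
  simpa only [Fin.succ_castSucc, Fin.snoc_castSucc, Fin.succ_last, Fin.snoc_last, h0, hl] using key

lemma chainDistEps_le_add_sum (x : X) {ε : ℝ} {k : ℕ} (c : Fin (k + 1) → X)
    (hc : ∀ i : Fin k, dist (c i.castSucc) (c i.succ) < ε) :
    chainDistEps Set.univ x (c (Fin.last k)) ε ≤ chainDistEps Set.univ x (c 0) ε +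
      ∑ i : Fin k, ENNReal.ofReal (dist (c i.castSucc) (c i.succ)) := by
  induction k with
  | zero => simp
  | succ k ih =>
    have h1 := ih (fun i => c i.castSucc) fun i => hc i.castSucc
    have h2 := chainDistEps_le_add_dist x (hc (Fin.last k))
    rw [Fin.sum_univ_castSucc, ← add_assoc]
    exact h2.trans (add_le_add_left h1 _)

lemma chainDistEps_triangle (x y z : X) (ε : ℝ) :
    chainDistEps Set.univ x z ε ≤ chainDistEps Set.univ x y ε + chainDistEps Set.univ y z ε := by
  conv_rhs => rw [chainDistEps.eq_def Set.univ y z]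
  simp only [ENNReal.add_iInf]
  refine le_iInf fun k => le_iInf fun c => le_iInf fun h0 => le_iInf fun hl => le_iInf fun _ =>
    le_iInf fun hc => ?_
  subst h0 hl
  exact chainDistEps_le_add_sum x c hc

lemma chainDistEps_le_chainDist (A : Set X) (x y : X) {ε : ℝ} (hε : 0 < ε) :
    chainDistEps A x y ε ≤ chainDist A x y :=
  le_iSup₂_of_le ε hε le_rfl

lemma chainDist_triangle (x y z : X) :
    chainDist Set.univ x z ≤ chainDist Set.univ x y + chainDist Set.univ y z :=
  iSup₂_le fun ε hε => (chainDistEps_triangle x y z ε).trans <|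
    add_le_add (chainDistEps_le_chainDist _ x y hε) (chainDistEps_le_chainDist _ y z hε)

lemma chainDist_self (x : X) : chainDist Set.univ x x = 0 :=
  le_antisymm (iSup₂_le fun ε _ => by
    simpa using chainDistEps_le_sum ε (fun _ : Fin (0 + 1) => x) fun i => i.elim0) zero_le

lemma LipschitzWith.chainDist_le {Y : Type*} [MetricSpace Y] {f : X → Y} {r : ℝ≥0}
    (hf : LipschitzWith r f) (h0 : r ≠ 0) (h1 : r ≤ 1) (x y : X) :
    chainDist Set.univ (f x) (f y) ≤ r * chainDist Set.univ x y := by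
  have hr0 : (r : ℝ≥0∞) ≠ 0 := by simpa using h0
  have hdist (a b : X) : dist (f a) (f b) ≤ r * dist a b := hf.dist_le_mul a b
  refine iSup₂_le fun ε hε =>
    le_trans ?_ (mul_le_mul_right (chainDistEps_le_chainDist _ x y hε) (r : ℝ≥0∞))
  conv_rhs => rw [chainDistEps]
  simp only [ENNReal.mul_iInf_of_ne hr0 ENNReal.coe_ne_top]
  refine le_iInf fun k => le_iInf fun c => le_iInf fun h0 => le_iInf fun hl => le_iInf fun _ =>
    le_iInf fun hc => ?_
  subst h0 hl
  refine (chainDistEps_le_sum ε (fun i => f (c i)) fun i => ?_).trans ?_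
  · exact ((hdist _ _).trans (mul_le_of_le_one_left dist_nonneg (by exact_mod_cast h1))).trans_lt
      (hc i)
  · rw [Finset.mul_sum]
    refine Finset.sum_le_sum fun i _ => ?_
    rw [← ENNReal.ofReal_coe_nnreal, ← ENNReal.ofReal_mul r.coe_nonneg]
    exact ENNReal.ofReal_le_ofReal (hdist _ _)

lemma isClosed_setOf_chainDist_le (x : X) (M : ℝ≥0∞) :
    IsClosed {y | chainDist Set.univ x y ≤ M} := by
  refine isClosed_of_closure_subset fun y hy => ?_
  refine show chainDist Set.univ x y ≤ M from iSup₂_le fun ε hε => ?_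
  refine ENNReal.le_of_forall_pos_le_add fun δ hδ _ => ?_
  obtain ⟨z, hz, hyz⟩ := Metric.mem_closure_iff.1 hy (min ε δ) (lt_min hε hδ)
  rw [dist_comm] at hyz
  refine (chainDistEps_le_add_dist x (hyz.trans_le (min_le_left _ _))).trans (add_le_add ?_ ?_)
  · exact (chainDistEps_le_chainDist _ x z hε).trans hz
  · exact (ENNReal.ofReal_le_ofReal (hyz.trans_le (min_le_right _ _)).le).trans
      ENNReal.ofReal_coe_nnreal.le

end ChainDist

/-- A nonempty closed set mapped into itself by all maps of a contractive system with attractor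
the whole compact space is the whole space. -/
lemma eq_univ_of_mapsTo_of_iUnion_range_eq_univ {K ι : Type*} [MetricSpace K] [CompactSpace K]
    {f : ι → K → K} (hf : ∀ i, ∃ r : ℝ≥0, r < 1 ∧ LipschitzWith r (f i))
    (hcov : (⋃ i, Set.range (f i)) = Set.univ) {A : Set K} (hA : IsClosed A) (hne : A.Nonempty)
    (hmaps : ∀ i, Set.MapsTo (f i) A A) : A = Set.univ := by
  obtain ⟨a, ha⟩ := hne
  obtain ⟨y, -, hy⟩ := isCompact_univ.exists_isMaxOn ⟨a, Set.mem_univ a⟩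
    (Metric.continuous_infDist_pt A).continuousOn
  have hmax (z : K) : Metric.infDist z A ≤ Metric.infDist y A := hy (Set.mem_univ z)
  obtain ⟨i, z, rfl⟩ := Set.mem_iUnion.1 (hcov.symm ▸ Set.mem_univ y)
  obtain ⟨r, hr, hlip⟩ := hf i
  obtain ⟨w, hwA, hw⟩ := hA.isCompact.exists_infDist_eq_dist ⟨a, ha⟩ z
  have hle : Metric.infDist (f i z) A ≤ r * Metric.infDist z A := by
    rw [hw]
    exact (Metric.infDist_le_dist_of_mem (hmaps i hwA)).trans (hlip.dist_le_mul z w)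
  have hr' : (r : ℝ) < 1 := by exact_mod_cast hr
  have hz := hmax z
  have hzero : Metric.infDist (f i z) A = 0 := by
    nlinarith [r.coe_nonneg, Metric.infDist_nonneg (x := f i z) (s := A),
      mul_le_mul_of_nonneg_left hz r.coe_nonneg]
  refine Set.eq_univ_of_forall fun x => (hA.mem_iff_infDist_zero ⟨a, ha⟩).2 ?_
  exact le_antisymm ((hmax x).trans hzero.le) Metric.infDist_nonneg

/-- Let `K` be a compact connected metric space with at least two points and
`p ∈ K` be such that `d̃(x,y,K) < ∞` for all `x, y ≠ p` and `d̃(x,p,K) = ∞` for all `x ≠ p`.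
Then `K` is not the attractor of any IFS on `K`. -/
theorem not_attractor_of_chainDist {K : Type*} [MetricSpace K] [CompactSpace K]
    [ConnectedSpace K] [Nontrivial K] (p : K)
    (hfin : ∀ x y : K, x ≠ p → y ≠ p → chainDist (Set.univ : Set K) x y < ⊤)
    (hinf : ∀ x : K, x ≠ p → chainDist (Set.univ : Set K) x p = ⊤) :
    ¬ ∃ (m : ℕ) (f : Fin m → K → K),
        (∀ i, ∃ lam : ℝ≥0, lam < 1 ∧ LipschitzWith lam (f i)) ∧
        (⋃ i, Set.range (f i)) = Set.univ := by
  rintro ⟨m, f, hf, hcov⟩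
  obtain ⟨o, ho⟩ := exists_ne p
  have hpos : ∀ i, ∃ r : ℝ≥0, r ≠ 0 ∧ r < 1 ∧ LipschitzWith r (f i) := fun i => by
    obtain ⟨r, hr, hlip⟩ := hf i
    refine ⟨max r (1 / 2), ?_, max_lt hr ?_, hlip.weaken (le_max_left _ _)⟩
    · exact (lt_max_of_lt_right (by norm_num)).ne'
    · exact NNReal.half_lt_self one_ne_zero
  choose r hr0 hr1 hlip using hpos
  set g : K → ℝ≥0 := fun x => (chainDist Set.univ o x).toNNReal
  have hg (x : K) (hx : x ≠ p) : chainDist Set.univ o x = g x :=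
    (ENNReal.coe_toNNReal (hfin o x ho hx).ne).symm
  let b : Fin m → ℝ≥0 := fun i => g (f i o) / (1 - r i) + g (f i p)
  have hb (i : Fin m) : b i ≤ ∑ j, b j :=
    Finset.single_le_sum (fun _ _ => zero_le) (Finset.mem_univ i)
  set M : ℝ≥0 := ∑ j, b j
  set A : Set K := {x | chainDist Set.univ o x ≤ M}
  have hpA : p ∉ A := fun h => by
    have h' : chainDist Set.univ o p ≤ M := h
    simp [hinf o ho] at h'
  have hoA : o ∈ A := (chainDist_self o).trans_le zero_le
  have hA : IsClosed A := isClosed_setOf_chainDist_le o M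
  have hmaps (i : Fin m) : Set.MapsTo (f i) (insert p A) (insert p A) := by
    intro x hx
    by_cases hfx : f i x = p
    · exact Or.inl hfx
    right
    change chainDist Set.univ o (f i x) ≤ M
    rcases hx with rfl | hx
    · rw [hg _ hfx]
      exact_mod_cast le_add_self.trans (hb i)
    have hxp : x ≠ p := fun h => hpA (h ▸ hx)
    have hfo : f i o ≠ p := fun h => by
      have h1 := (hlip i).chainDist_le (hr0 i) (hr1 i).le x o
      rw [h, hinf _ hfx] at h1
      exact (ENNReal.mul_lt_top ENNReal.coe_lt_top (hfin x o hxp ho)).not_ge h1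
    have hgo : g (f i o) ≤ M * (1 - r i) :=
      (div_le_iff₀ (tsub_pos_of_lt (hr1 i))).1 (le_self_add.trans (hb i))
    calc chainDist Set.univ o (f i x)
        ≤ chainDist Set.univ o (f i o) + chainDist Set.univ (f i o) (f i x) :=
          chainDist_triangle _ _ _
      _ ≤ g (f i o) + r i * M := by
          rw [hg _ hfo]
          gcongr
          exact ((hlip i).chainDist_le (hr0 i) (hr1 i).le o x).trans (mul_le_mul_right hx _)
      _ ≤ (M * (1 - r i) + r i * M : ℝ≥0) := by
          rw [ENNReal.coe_add, ENNReal.coe_mul (r i)]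
          gcongr
      _ = M := by
          rw [mul_comm (r i), ← mul_add, tsub_add_cancel_of_le (hr1 i).le, mul_one]
  have huniv : insert p A = Set.univ :=
    eq_univ_of_mapsTo_of_iUnion_range_eq_univ hf hcov
      (Set.insert_eq p A ▸ isClosed_singleton.union hA) (Set.insert_nonempty p A) hmaps
  have hcompl : A = {p}ᶜ := by
    ext x
    refine ⟨fun hx h => hpA (h ▸ hx), fun hx => ?_⟩
    exact (huniv.symm ▸ Set.mem_univ x : x ∈ insert p A).resolve_left hx
  have hclopen : IsClopen A := ⟨hA, hcompl ▸ isOpen_compl_singleton⟩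
  rcases isClopen_iff.1 hclopen with h | h
  · exact Set.notMem_empty o (h ▸ hoA)
  · exact hpA (h ▸ Set.mem_univ p)
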